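/- Discrete mass conservation: any solution (U^{(n)}, P^{(n)}) of the structure-preserving scheme satisfies M_d(U^{(n+1)}) = M_d(U^{(n)}) for all n, where M_d(U) := Σ''_{k=0}^{K} U_k Δx. -/

import Mathlib

/-- Discrete mass M_d(U) = Σ''_{k=0}^{K} U_k Δx. -/
noncomputable def Md (K : ℕ) (Δx : ℝ) (U : ℤ → ℝ) : ℝ :=
  ((1/2) * U 0 + (∑ k ∈ Finset.Ioo 0 K, U (k : ℤ)) + (1/2) * U (K : ℤ)) * Δx

/-- Summation by parts against a constant: the trapezoidal sum of second differences is the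
difference of the central first differences at the two endpoints. -/
theorem trapezoidal_sum_second_difference (p : ℤ → ℝ) {K : ℕ} (hK : 1 ≤ K) :
    (1 / 2) * (p (0 + 1) - 2 * p 0 + p (0 - 1)) +
        (∑ k ∈ Finset.Ioo 0 K, (p ((k : ℤ) + 1) - 2 * p k + p ((k : ℤ) - 1))) +
        (1 / 2) * (p ((K : ℤ) + 1) - 2 * p K + p ((K : ℤ) - 1)) =
      (p ((K : ℤ) + 1) - p ((K : ℤ) - 1)) / 2 - (p (0 + 1) - p (0 - 1)) / 2 := by
  induction K, hK using Nat.le_induction with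
  | base =>
    have hIoo : Finset.Ioo 0 1 = (∅ : Finset ℕ) := by decide
    rw [hIoo]
    norm_num
    ring
  | succ m hm ih =>
    have hIoo : Finset.Ioo 0 (m + 1) = insert m (Finset.Ioo 0 m) := by
      ext k
      simp only [Finset.mem_Ioo, Finset.mem_insert]
      omega
    rw [hIoo, Finset.sum_insert (by simp)]
    push_cast
    rw [add_sub_cancel_right]
    linarith

/-- Discrete mass conservation for the structure-preserving scheme. -/
theorem discrete_mass_conservation (K : ℕ) (hK : 1 ≤ K) (Δx Δt : ℝ)
    (hΔx : 0 < Δx) (hΔt : 0 < Δt) (U P : ℕ → ℤ → ℝ)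
    (scheme1 : ∀ n : ℕ, ∀ k : ℤ, 0 ≤ k → k ≤ K →
      (U (n + 1) k - U n k) / Δt = (P n (k + 1) - 2 * P n k + P n (k - 1)) / Δx ^ 2)
    (nbc : ∀ n : ℕ, ∀ k : ℤ, k = 0 ∨ k = (K : ℤ) →
      (P n (k + 1) - P n (k - 1)) / (2 * Δx) = 0) :
    ∀ n : ℕ, Md K Δx (U (n + 1)) = Md K Δx (U n) := by
  intro n
  have step : ∀ k : ℤ, 0 ≤ k → k ≤ K → U (n + 1) k =
      U n k + Δt / Δx ^ 2 * (P n (k + 1) - 2 * P n k + P n (k - 1)) := by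
    intro k h0 hk
    have h := scheme1 n k h0 hk
    field_simp at h ⊢
    linarith
  have flux : ∀ k : ℤ, k = 0 ∨ k = (K : ℤ) → P n (k + 1) - P n (k - 1) = 0 := by
    intro k hk
    simpa [hΔx.ne'] using nbc n k hk
  have hsum : ∑ k ∈ Finset.Ioo 0 K, U (n + 1) (k : ℤ) = ∑ k ∈ Finset.Ioo 0 K, U n (k : ℤ) +
      Δt / Δx ^ 2 *
        ∑ k ∈ Finset.Ioo 0 K, (P n ((k : ℤ) + 1) - 2 * P n k + P n ((k : ℤ) - 1)) := by
    rw [Finset.mul_sum, ← Finset.sum_add_distrib]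
    refine Finset.sum_congr rfl fun k hk => step k (by positivity) ?_
    exact_mod_cast (Finset.mem_Ioo.mp hk).2.le
  have key := trapezoidal_sum_second_difference (P n) hK
  rw [flux 0 (Or.inl rfl), flux K (Or.inr rfl)] at key
  unfold Md
  rw [hsum, step 0 le_rfl (by positivity), step K (by positivity) le_rfl]
  linear_combination (Δx * (Δt / Δx ^ 2)) * key
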